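/- Let k be a field, 1 ≤ d ≤ n, B = k[x₁^{±1}, …, x_d^{±1}, x_{d+1}, …, xₙ], and A a k-subalgebra of B which is a k-retract of B. If tr.deg_k A ∈ {0, 1, n}, then the fraction field Q(A) of A is rational over k, i.e., Q(A) is k-isomorphic to the field of rational functions k(t₁, …, t_m) in m = tr.deg_k A variables over k. -/

import Mathlib

/-- The transcendence degree of a `k`-algebra `A`: the supremum of the cardinalities of
algebraically independent subsets of `A` over `k`.  For an integral domain `A` this equals
the transcendence degree of `Q(A)` over `k`. -/
noncomputable def trdeg (k A : Type*) [CommRing k] [CommRing A] [Algebra k A] : Cardinal :=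
  ⨆ s : { s : Set A // AlgebraicIndependent k ((↑) : s → A) }, Cardinal.mk s.1

/-- The mixed Laurent/polynomial ring `k[x₁^{±1}, …, x_d^{±1}, x_{d+1}, …, x_{d+m}]`,
realized as the monoid algebra of `ℤ^d × ℕ^m` over `k`. -/
abbrev MixedLaurent (k : Type*) [CommRing k] (d m : ℕ) : Type _ :=
  AddMonoidAlgebra k ((Fin d → ℤ) × (Fin m → ℕ))

open Function

/-- A ring homomorphism from a domain `A` algebraic over `S` is injective as soon as it is
injective on the image of `S`. -/
theorem RingHom.injective_of_isAlgebraic {S A C : Type*} [CommRing S] [CommRing A] [IsDomain A]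
    [CommRing C] [Algebra S A] [Algebra.IsAlgebraic S A] (f : A →+* C)
    (hf : Injective (f.comp (algebraMap S A))) : Injective f := by
  refine (injective_iff_map_eq_zero f).mpr fun a ha ↦ by_contra fun ha0 ↦ ?_
  obtain ⟨r, hr, b, hb⟩ := (Algebra.IsAlgebraic.isAlgebraic (R := S) a).exists_nonzero_dvd
    (mem_nonZeroDivisors_of_ne_zero ha0)
  refine hr ((injective_iff_map_eq_zero _).mp hf r ?_)
  rw [RingHom.comp_apply, hb, map_mul, ha, zero_mul]

/-- Finitely many points of an additive monoid embedded in `ℤⁿ` are separated by an additive map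
to `ℤ`. -/
theorem exists_addMonoidHom_int_injOn {M : Type*} [AddCommMonoid M] {n : ℕ}
    (ι : M →+ (Fin n → ℤ)) (hι : Injective ι) (s : Finset M) :
    ∃ w : M →+ ℤ, Set.InjOn w s := by
  classical
  let p (x : M) : Polynomial ℤ := ∑ i : Fin n, Polynomial.monomial (i : ℕ) (ι x i)
  have hcoeff (x : M) (i : Fin n) : (p x).coeff i = ι x i := by
    simp [p, Polynomial.coeff_monomial, Fin.val_inj]
  have hp : Injective p := fun x y hxy ↦ hι <| funext fun i ↦ by
    rw [← hcoeff, ← hcoeff, hxy]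
  let q : Polynomial ℤ := ∏ z ∈ s.offDiag, (p z.1 - p z.2)
  have hq : q ≠ 0 := Finset.prod_ne_zero_iff.mpr fun z hz ↦
    sub_ne_zero.mpr (hp.ne (Finset.mem_offDiag.mp hz).2.2)
  obtain ⟨N, hN⟩ : ∃ N : ℤ, q.eval N ≠ 0 := by
    by_contra! h
    exact hq (Polynomial.funext fun N ↦ by simpa using h N)
  refine ⟨{ toFun x := (p x).eval N, map_zero' := ?_, map_add' x y := ?_ }, ?_⟩
  · simp [p]
  · simp [p, Finset.sum_add_distrib]
  · intro x hx y hy hxy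
    by_contra hne
    rw [Polynomial.eval_prod, Finset.prod_ne_zero_iff] at hN
    refine hN (x, y) (Finset.mem_offDiag.mpr ⟨hx, hy, hne⟩) ?_
    simpa [sub_eq_zero] using hxy

/-- Laurent polynomials embed in rational functions. -/
theorem LaurentPolynomial.exists_injective_algHom_ratFunc (k : Type*) [Field k] :
    ∃ g : LaurentPolynomial k →ₐ[k] RatFunc k, Injective g := by
  have hu (y : Submonoid.powers (Polynomial.X : Polynomial k)) :
      IsUnit (IsScalarTower.toAlgHom k (Polynomial k) (RatFunc k) y) := by
    obtain ⟨_, n, rfl⟩ := y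
    exact (map_ne_zero_iff _ (RatFunc.algebraMap_injective k)).mpr
      (pow_ne_zero n Polynomial.X_ne_zero) |>.isUnit
  have : IsScalarTower k (Polynomial k) (LaurentPolynomial k) :=
    IsScalarTower.of_algebraMap_eq fun r ↦ by simp
  let g : LaurentPolynomial k →ₐ[k] RatFunc k := IsLocalization.liftAlgHom hu
  have hg (p : Polynomial k) : g (Polynomial.toLaurent p) = algebraMap _ (RatFunc k) p :=
    IsLocalization.lift_eq (S := LaurentPolynomial k) hu p
  refine ⟨g, (injective_iff_map_eq_zero g).mpr fun f hf ↦ ?_⟩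
  obtain ⟨n, p, hp⟩ := LaurentPolynomial.exists_T_pow f
  have : p = 0 := by
    apply RatFunc.algebraMap_injective k
    rw [← hg, hp, map_mul, hf, zero_mul, map_zero]
  rw [this, map_zero, eq_comm] at hp
  exact (LaurentPolynomial.isUnit_T n).mul_left_eq_zero.mp hp

theorem RatFunc.exists_algHom_transcendental {k M : Type*} [Field k] [AddCommMonoid M] {n : ℕ}
    (ι : M →+ (Fin n → ℤ)) (hι : Injective ι) {a : AddMonoidAlgebra k M}
    (ha : ∀ c, a ≠ algebraMap k _ c) :
    ∃ θ : AddMonoidAlgebra k M →ₐ[k] RatFunc k, Transcendental k (θ a) := by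
  classical
  obtain ⟨w, hw⟩ := exists_addMonoidHom_int_injOn ι hι (insert 0 a.coeff.support)
  obtain ⟨g, hg⟩ := LaurentPolynomial.exists_injective_algHom_ratFunc k
  refine ⟨g.comp (AddMonoidAlgebra.mapDomainAlgHom k k w),
    RatFunc.transcendental_of_ne_C _ ?_⟩
  rintro ⟨c, hc⟩
  have h : AddMonoidAlgebra.mapDomainAlgHom k k w a =
      AddMonoidAlgebra.mapDomainAlgHom k k w (algebraMap k _ c) := by
    apply hg
    rw [AlgHom.commutes, AlgHom.commutes]
    exact hc
  refine ha c (AddMonoidAlgebra.coeff_injective (Finsupp.mapDomain_injOn _ hw ?_ ?_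
    (congrArg AddMonoidAlgebra.coeff h)))
  · exact_mod_cast Finset.subset_insert _ _
  · intro x hx
    have : x = 0 := by
      by_contra hx0
      simp [AddMonoidAlgebra.coe_algebraMap, Ne.symm hx0] at hx
    simp [this]

/-- Lüroth's theorem for a domain of transcendence degree one with a homomorphism to `k(X)` not
sending all of it to algebraic elements. -/
theorem RatFunc.nonempty_algEquiv_fractionRing_of_trdeg_eq_one {k A : Type*} [Field k]
    [CommRing A] [IsDomain A] [Algebra k A] (htr : Algebra.trdeg k A = 1)
    (θ : A →ₐ[k] RatFunc k) {a : A} (ha : Transcendental k (θ a)) :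
    Nonempty (RatFunc k ≃ₐ[k] FractionRing A) := by
  have hindep : AlgebraicIndependent k fun _ : PUnit ↦ a :=
    (algebraicIndependent_unique_type_iff).mpr fun h ↦ ha (h.algHom θ)
  have hbasis : IsTranscendenceBasis k fun _ : PUnit ↦ a :=
    hindep.isTranscendenceBasis_of_trdeg_le (by simp [htr]) (by simp [htr])
  have := hbasis.isAlgebraic
  have hθ : Injective θ := by
    refine RingHom.injective_of_isAlgebraic
      (S := Algebra.adjoin k (Set.range fun _ : PUnit ↦ a)) (θ : A →+* RatFunc k) ?_
    refine (injective_iff_map_eq_zero _).mpr fun ⟨x, hx⟩ h0 ↦ ?_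
    rw [Set.range_const, Algebra.adjoin_singleton_eq_range_aeval] at hx
    obtain ⟨p, rfl⟩ := hx
    have h0 : θ (Polynomial.aeval a p) = 0 := h0
    rw [← Polynomial.aeval_algHom_apply] at h0
    have : p = 0 := by_contra fun hp ↦ ha ⟨p, hp, h0⟩
    exact Subtype.ext (by simp [this])
  let Θ : FractionRing A →ₐ[k] RatFunc k := IsFractionRing.liftAlgHom hθ
  have hE : Θ.fieldRange ≠ ⊥ := by
    intro h
    have hmem : θ a ∈ Θ.fieldRange := ⟨algebraMap A _ a, by simp [Θ]⟩
    rw [h, IntermediateField.mem_bot] at hmem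
    obtain ⟨c, hc⟩ := hmem
    exact ha (hc ▸ isAlgebraic_algebraMap c)
  exact ⟨(RatFunc.Luroth.algEquiv hE).trans (AlgEquiv.ofInjectiveField Θ).symm⟩

namespace MixedLaurent

variable (k : Type*) [Field k] (d m : ℕ)

/-- The exponent of a monomial in `d + m` variables, as an exponent of the mixed
Laurent/polynomial ring. -/
def exponentHom : (Fin d ⊕ Fin m →₀ ℕ) →+ (Fin d → ℤ) × (Fin m → ℕ) where
  toFun e := (fun i ↦ e (.inl i), fun j ↦ e (.inr j))
  map_zero' := by ext <;> simp
  map_add' x y := by ext <;> simp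

theorem exponentHom_injective : Injective (exponentHom d m) := by
  intro x y h
  ext (i | j)
  · exact Int.ofNat_inj.mp (congrFun (congrArg Prod.fst h) i)
  · exact congrFun (congrArg Prod.snd h) j

/-- The inclusion of the polynomial ring in the mixed Laurent/polynomial ring. -/
noncomputable def ofMvPolynomial : MvPolynomial (Fin d ⊕ Fin m) k →ₐ[k] MixedLaurent k d m :=
  AddMonoidAlgebra.mapDomainAlgHom k k (exponentHom d m)

theorem ofMvPolynomial_injective : Injective (ofMvPolynomial k d m) :=
  AddMonoidAlgebra.mapDomain_injective (exponentHom_injective d m)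

theorem ofMvPolynomial_monomial (e : Fin d ⊕ Fin m →₀ ℕ) (r : k) :
    ofMvPolynomial k d m (MvPolynomial.monomial e r) = .single (exponentHom d m e) r :=
  AddMonoidAlgebra.mapDomain_single

theorem exists_exponentHom_add (e : (Fin d → ℤ) × (Fin m → ℕ)) :
    ∃ u v, e + exponentHom d m u = exponentHom d m v := by
  refine ⟨Finsupp.equivFunOnFinite.symm (Sum.elim (fun i ↦ (-e.1 i).toNat) 0),
    Finsupp.equivFunOnFinite.symm (Sum.elim (fun i ↦ (e.1 i).toNat) e.2), ?_⟩
  ext i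
  · simp [exponentHom]
    omega
  · simp [exponentHom]

theorem nonempty_algEquiv_fractionRing :
    Nonempty (FractionRing (MvPolynomial (Fin d ⊕ Fin m) k) ≃ₐ[k]
      FractionRing (MixedLaurent k d m)) := by
  let B := MixedLaurent k d m
  let g : MvPolynomial (Fin d ⊕ Fin m) k →ₐ[k] FractionRing B :=
    (IsScalarTower.toAlgHom k B (FractionRing B)).comp (ofMvPolynomial k d m)
  have hg : Injective g :=
    (IsFractionRing.injective B (FractionRing B)).comp (ofMvPolynomial_injective k d m)
  let f : FractionRing (MvPolynomial (Fin d ⊕ Fin m) k) →ₐ[k] FractionRing B :=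
    IsFractionRing.liftAlgHom hg
  have hfg (p) : g p ∈ f.fieldRange := ⟨algebraMap _ _ p, by simp [f]⟩
  have hB (b : B) : algebraMap B (FractionRing B) b ∈ f.fieldRange := by
    induction b using AddMonoidAlgebra.induction_linear with
    | zero => simp
    | add x y hx hy => rw [map_add]; exact add_mem hx hy
    | single e r =>
      obtain ⟨u, v, huv⟩ := exists_exponentHom_add d m e
      have hmul : algebraMap B (FractionRing B) (.single e r) * g (MvPolynomial.monomial u 1) =
          g (MvPolynomial.monomial v r) := by
        change algebraMap B _ _ * algebraMap B _ (ofMvPolynomial k d m _) =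
          algebraMap B _ (ofMvPolynomial k d m _)
        rw [← map_mul, ofMvPolynomial_monomial, ofMvPolynomial_monomial,
          AddMonoidAlgebra.single_mul_single, huv, mul_one]
      have hne : g (MvPolynomial.monomial u 1) ≠ 0 :=
        (map_ne_zero_iff g hg).mpr (by simp)
      rw [eq_div_of_mul_eq hne hmul]
      exact div_mem (hfg _) (hfg _)
  refine ⟨AlgEquiv.ofBijective f ⟨f.injective, fun z ↦ ?_⟩⟩
  obtain ⟨x, y, -, rfl⟩ := IsFractionRing.div_surjective B z
  exact div_mem (hB x) (hB y)

theorem trdeg_eq : Algebra.trdeg k (MixedLaurent k d m) = (d + m : ℕ) := by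
  obtain ⟨e⟩ := nonempty_algEquiv_fractionRing k d m
  have h (R : Type _) [CommRing R] [IsDomain R] [Algebra k R] :
      Algebra.trdeg k (FractionRing R) = Algebra.trdeg k R := by
    have := IsLocalization.isAlgebraic (FractionRing R) (nonZeroDivisors R)
    rw [← trdeg_add_eq k R, trdeg_eq_zero (R := R), add_zero]
  rw [← h, ← e.trdeg_eq, h]
  simp

/-- Integer exponents of the monomials of the mixed Laurent/polynomial ring. -/
def intExponentHom : (Fin d → ℤ) × (Fin m → ℕ) →+ (Fin (d + m) → ℤ) where
  toFun e := Fin.append e.1 (fun j ↦ (e.2 j : ℤ))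
  map_zero' := by ext i; refine Fin.addCases ?_ ?_ i <;> simp
  map_add' x y := by ext i; refine Fin.addCases ?_ ?_ i <;> simp

theorem intExponentHom_injective : Injective (intExponentHom d m) := by
  intro x y h
  ext i
  · simpa [intExponentHom] using congrFun h (Fin.castAdd m i)
  · simpa [intExponentHom] using congrFun h (Fin.natAdd d i)

variable {k d m}
variable (A : Subalgebra k (MixedLaurent k d m))

theorem subalgebra_bijective_algebraMap [Algebra.IsAlgebraic k A] :
    Bijective (algebraMap k A) := by
  let ε : A →ₐ[k] k := (AddMonoidAlgebra.lift k k _ 1).comp A.val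
  have hε : Injective ε := RingHom.injective_of_isAlgebraic (S := k) (ε : A →+* k)
    (RingHom.injective _)
  exact ⟨(algebraMap k A).injective, fun a ↦ ⟨ε a, hε (by simp)⟩⟩

theorem retract_injective (φ : MixedLaurent k d m →ₐ[k] A)
    (hφ : ∀ a : A, φ (a : MixedLaurent k d m) = a)
    (htr : Algebra.trdeg k A = (d + m : ℕ)) : Injective φ := by
  have hadd := trdeg_add_eq k A (A := MixedLaurent k d m)
  rw [trdeg_eq, htr] at hadd
  have halg : Algebra.IsAlgebraic A (MixedLaurent k d m) :=
    trdeg_eq_zero_iff.mp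
      (Cardinal.eq_of_add_eq_add_left (hadd.trans (add_zero _).symm) Cardinal.natCast_lt_aleph0)
  exact RingHom.injective_of_isAlgebraic (S := A) (φ : MixedLaurent k d m →+* A)
    (LeftInverse.injective (g := id) hφ)

end MixedLaurent

/-- Let `k` be a field, `1 ≤ d`, `B = k[x₁^{±1}, …, x_d^{±1}, x_{d+1}, …, xₙ]` (with
`n = d + m`) and `A` a `k`-subalgebra of `B` which is a `k`-retract of `B`.  If
`tr.deg_k A ∈ {0, 1, n}`, then the fraction field `Q(A)` is rational over `k`: it is
`k`-isomorphic to the rational function field `k(t₁, …, t_t)` in `t = tr.deg_k A`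
variables. -/
theorem retract_fraction_field_rational_of_trdeg (k : Type*) [Field k] (d m : ℕ) (hd : 1 ≤ d)
    (A : Subalgebra k (MixedLaurent k d m))
    (φ : MixedLaurent k d m →ₐ[k] A) (hφ : ∀ a : A, φ (a : MixedLaurent k d m) = a)
    (htr : trdeg k A = 0 ∨ trdeg k A = 1 ∨ trdeg k A = ((d + m : ℕ) : Cardinal)) :
    ∃ t : ℕ, (t : Cardinal) = trdeg k A ∧
      Nonempty (FractionRing A ≃ₐ[k] FractionRing (MvPolynomial (Fin t) k)) := by
  have htrdeg : trdeg k A = Algebra.trdeg k A := rfl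
  rw [htrdeg] at htr ⊢
  rcases htr with h | h | h
  · refine ⟨0, by simp [h], ⟨?_⟩⟩
    have := trdeg_eq_zero_iff.mp h
    exact IsFractionRing.algEquivOfAlgEquiv (R := k)
      ((AlgEquiv.ofBijective (Algebra.ofId k A)
        (MixedLaurent.subalgebra_bijective_algebraMap A)).symm.trans
          (MvPolynomial.isEmptyAlgEquiv k (Fin 0)).symm)
  · refine ⟨1, by simp [h], ?_⟩
    obtain ⟨a, ha⟩ := (trdeg_ne_zero_iff (R := k) (A := A)).mp (by simp [h])
    obtain ⟨θ, hθ⟩ := RatFunc.exists_algHom_transcendental (k := k)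
      (MixedLaurent.intExponentHom d m) (MixedLaurent.intExponentHom_injective d m)
      (a := (a : MixedLaurent k d m)) fun c hc ↦
        ha ((Subtype.ext hc : a = algebraMap k A c) ▸ isAlgebraic_algebraMap c)
    obtain ⟨e⟩ :=
      RatFunc.nonempty_algEquiv_fractionRing_of_trdeg_eq_one h (θ.comp A.val) (a := a) hθ
    exact ⟨e.symm.trans
      (IsFractionRing.algEquivOfAlgEquiv (MvPolynomial.uniqueAlgEquiv k (Fin 1)).symm)⟩
  · refine ⟨d + m, h.symm, ?_⟩
    obtain ⟨e⟩ := MixedLaurent.nonempty_algEquiv_fractionRing k d m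
    have hinj := MixedLaurent.retract_injective A φ hφ h
    exact ⟨(IsFractionRing.algEquivOfAlgEquiv
      (AlgEquiv.ofBijective φ ⟨hinj, fun a ↦ ⟨a, hφ a⟩⟩).symm).trans <| e.symm.trans <|
        IsFractionRing.algEquivOfAlgEquiv
          (MvPolynomial.renameEquiv k (finSumFinEquiv (m := d) (n := m)))⟩
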